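/- arXiv:math/0612606 — 3 statements merged into one kernel-verified Lean document; each statement's English description precedes it below -/
import Mathlib

section
/- Assume 𝐒 is not bounded but 𝐒₋₁ is bounded on 𝐄. Let T be a Toeplitz operator on 𝐄. Then for every z in the open region { z ∈ ℂ : |z| > 1/ρ(𝐒₋₁) } the series T̃(z) = Σ_{n∈ℤ} T̂(n) zⁿ converges, and T̃ is holomorphic there with |T̃(z)| ≤ ‖T‖ (i.e. T̃ belongs to H^∞ of the open exterior region { |z| > 1/ρ(𝐒₋₁) }). -/
open scoped ENNReal

lemma aux_integral_fourier (n : ℤ) :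
    ∫ t : UnitAddCircle, fourier n t ∂AddCircle.haarAddCircle = if n = 0 then 1 else 0 := by
  split_ifs with h
  · subst h
    simp
  · exact MeasureTheory.integral_eq_zero_of_add_right_eq_neg
      (fourier_add_half_inv_index h one_pos)

lemma aux_average
    {E : Type*} [NormedAddCommGroup E] [NormedSpace ℂ E] [CompleteSpace E]
    (ι : E →ₗ[ℂ] (ℕ → ℂ)) (hι : Function.Injective ι)
    (e : ℕ → E) (he : ∀ k : ℕ, ι (e k) = Pi.single k 1)
    (hdense : Dense (Submodule.span ℂ (Set.range e) : Set E))
    (hcoord : ∀ n : ℕ, Continuous fun x : E => ι x n)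
    (Γ : ℂ → E → E)
    (hΓ : ∀ z : ℂ, ‖z‖ = 1 → ∀ x : E, ∀ n : ℕ, ι (Γ z x) n = z ^ n * ι x n)
    (hΓiso : ∀ z : ℂ, ‖z‖ = 1 → ∀ x : E, ‖Γ z x‖ = ‖x‖)
    (T : E →L[ℂ] E) (d : ℤ) :
    ∃ A : E →L[ℂ] E, ‖A‖ ≤ ‖T‖ ∧
      ∀ k j : ℕ, ι (A (e k)) j = if (j : ℤ) - k = d then ι (T (e k)) j else 0 := by
  have hadd : ∀ z : ℂ, ‖z‖ = 1 → ∀ x y, Γ z (x + y) = Γ z x + Γ z y := by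
    intro z hz x y
    apply hι; ext n
    simp [hΓ z hz, mul_add]
  have hsmul : ∀ z : ℂ, ‖z‖ = 1 → ∀ (c : ℂ) x, Γ z (c • x) = c • Γ z x := by
    intro z hz c x
    apply hι; ext n
    simp [hΓ z hz]; ring
  have hsub : ∀ z : ℂ, ‖z‖ = 1 → ∀ x y, Γ z (x - y) = Γ z x - Γ z y := by
    intro z hz x y
    apply hι; ext n
    simp [hΓ z hz, mul_sub]
  have hek : ∀ z : ℂ, ‖z‖ = 1 → ∀ k, Γ z (e k) = z ^ k • e k := by
    intro z hz k
    apply hι; ext n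
    simp only [hΓ z hz, map_smul, he, Pi.smul_apply, smul_eq_mul]
    by_cases h : n = k
    · subst h; rfl
    · simp [h]
  have hspan : ∀ x ∈ Submodule.span ℂ (Set.range e), Continuous fun z : Circle => Γ z x := by
    intro x hx
    induction hx using Submodule.span_induction with
    | mem x h =>
      obtain ⟨k, rfl⟩ := h
      have : (fun z : Circle => Γ z (e k)) = fun z : Circle => (z : ℂ) ^ k • e k := by
        ext z; exact hek z (Circle.norm_coe z) k
      rw [this]
      fun_prop
    | zero =>
      have : (fun z : Circle => Γ z 0) = fun z : Circle => (0 : E) := by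
        ext z; simpa using hsmul z (Circle.norm_coe z) 0 0
      rw [this]
      fun_prop
    | add x y _ _ hx hy =>
      have : (fun z : Circle => Γ z (x + y)) = fun z : Circle => Γ z x + Γ z y := by
        ext z; exact hadd z (Circle.norm_coe z) x y
      rw [this]
      exact hx.add hy
    | smul c x _ hx =>
      have : (fun z : Circle => Γ z (c • x)) = fun z : Circle => c • Γ z x := by
        ext z; exact hsmul z (Circle.norm_coe z) c x
      rw [this]
      exact hx.const_smul c
  have hdist : ∀ (z : Circle) x y, dist (Γ z x) (Γ z y) = dist x y := by
    intro z x y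
    rw [dist_eq_norm, dist_eq_norm, ← hsub z (Circle.norm_coe z), hΓiso z (Circle.norm_coe z)]
  have hJ : Continuous fun p : Circle × E => Γ p.1 p.2 := by
    rw [Metric.continuous_iff']
    rintro ⟨z, x⟩ ε hε
    obtain ⟨y, hy, hxy⟩ := Metric.dense_iff.1 hdense x (ε / 5) (by positivity)
    have hc := Metric.continuous_iff'.1 (hspan y hxy) z (ε / 5) (by positivity)
    have h1 : ∀ᶠ p : Circle × E in nhds (z, x), dist (Γ p.1 y) (Γ z y) < ε / 5 :=
      (continuous_fst.tendsto (z, x)).eventually hc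
    have h2 : ∀ᶠ p : Circle × E in nhds (z, x), dist p.2 x < ε / 5 :=
      (continuous_snd.tendsto (z, x)).eventually (Metric.ball_mem_nhds x (by positivity))
    filter_upwards [h1, h2] with p hp1 hp2
    have a1 := hdist p.1 p.2 x
    have a2 := hdist p.1 x y
    have a3 := hdist z y x
    rw [Metric.mem_ball] at hy
    have a4 := dist_triangle (Γ p.1 p.2) (Γ p.1 x) (Γ z x)
    have a5 := dist_triangle (Γ p.1 x) (Γ p.1 y) (Γ z x)
    have a6 := dist_triangle (Γ p.1 y) (Γ z y) (Γ z x)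
    have a7 := dist_comm x y
    linarith
  let F : E → UnitAddCircle → E := fun x t =>
    Γ (AddCircle.toCircle t) (T (Γ ((AddCircle.toCircle t)⁻¹ : Circle) x))
  have hFc : ∀ x, Continuous (F x) := by
    intro x
    have h1 : Continuous fun t : UnitAddCircle => Γ ((AddCircle.toCircle t)⁻¹ : Circle) x :=
      hJ.comp ((AddCircle.continuous_toCircle.inv).prodMk continuous_const)
    exact hJ.comp (AddCircle.continuous_toCircle.prodMk (T.continuous.comp h1))
  have hFi : ∀ x, MeasureTheory.Integrable (F x) AddCircle.haarAddCircle := fun x =>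
    (hFc x).integrable_of_hasCompactSupport (HasCompactSupport.of_compactSpace _)
  have hFn : ∀ x t, ‖F x t‖ ≤ ‖T‖ * ‖x‖ := by
    intro x t
    simp only [F]
    rw [hΓiso _ (Circle.norm_coe _)]
    refine (T.le_opNorm _).trans ?_
    rw [hΓiso _ (Circle.norm_coe _)]
  let A0 : E →ₗ[ℂ] E :=
    { toFun := fun x => fourierCoeff (F x) d
      map_add' := by
        intro x y
        have : F (x + y) = F x + F y := by
          ext t
          simp [F, hadd _ (Circle.norm_coe _), -Circle.coe_inv]
        rw [this]
        exact congrFun (fourierCoeff.add (hFi x) (hFi y)) d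
      map_smul' := by
        intro c x
        have : F (c • x) = c • F x := by
          ext t
          simp [F, hsmul _ (Circle.norm_coe _), -Circle.coe_inv]
        rw [this, fourierCoeff.const_smul]; rfl }
  have hA0 : ∀ x, ‖A0 x‖ ≤ ‖T‖ * ‖x‖ := by
    intro x
    have := MeasureTheory.norm_integral_le_of_norm_le_const
      (μ := AddCircle.haarAddCircle) (f := fun t : UnitAddCircle => fourier (-d) t • F x t)
      (C := ‖T‖ * ‖x‖) (Filter.Eventually.of_forall fun t => by
        rw [norm_smul, fourier_apply, Circle.norm_coe, one_mul]; exact hFn x t)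
    simpa [A0, fourierCoeff] using this
  refine ⟨A0.mkContinuous ‖T‖ hA0, LinearMap.mkContinuous_norm_le _ (norm_nonneg _) _, ?_⟩
  intro k j
  let φ : E →L[ℂ] ℂ := ⟨(LinearMap.proj j).comp ι, hcoord j⟩
  have hφ : ∀ x, φ x = ι x j := fun x => rfl
  have key : ∀ t : UnitAddCircle,
      φ (fourier (-d) t • F (e k) t) = fourier (-d + j - k) t * ι (T (e k)) j := by
    intro t
    rw [map_smul, hφ]
    simp only [F]
    rw [hΓ _ (Circle.norm_coe _), hek _ (Circle.norm_coe _)]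
    simp only [map_smul, Pi.smul_apply, smul_eq_mul, fourier_apply, AddCircle.toCircle_zsmul]
    rw [zpow_sub, zpow_add]
    simp
    ring
  change ι (A0 (e k)) j = _
  rw [← hφ]
  change φ (∫ t : UnitAddCircle, fourier (-d) t • F (e k) t ∂AddCircle.haarAddCircle) = _
  rw [← φ.integral_comp_comm ((hFi (e k)).fourier_smul (-d))]
  simp_rw [key]
  rw [MeasureTheory.integral_mul_const, aux_integral_fourier]
  by_cases h : (j : ℤ) - k = d
  · rw [if_pos h, if_pos (by omega), one_mul]
  · rw [if_neg h, if_neg (by omega), zero_mul]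

lemma aux_pow_le {x y C : ℝ} (hy : 0 ≤ y) (h : ∀ m : ℕ, x ^ m ≤ C * y ^ m) : x ≤ y := by
  by_contra hlt
  push Not at hlt
  have hx : 0 < x := hy.trans_lt hlt
  have h1 : Filter.Tendsto (fun m : ℕ => C * (y / x) ^ m) Filter.atTop (nhds (C * 0)) :=
    (tendsto_pow_atTop_nhds_zero_of_lt_one (by positivity) ((div_lt_one hx).2 hlt)).const_mul C
  have h2 : ∀ m : ℕ, 1 ≤ C * (y / x) ^ m := by
    intro m
    rw [div_pow, ← mul_div_assoc, le_div_iff₀ (by positivity), one_mul]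
    exact h m
  have := ge_of_tendsto' h1 h2
  norm_num at this

/-- If `𝐒` is not bounded but `𝐒₋₁` is bounded, then for every Toeplitz operator `T`
the series `T̃(z) = Σ_{n∈ℤ} T̂(n) zⁿ` converges on `{ |z| > 1/ρ(𝐒₋₁) }`, and `T̃` is
holomorphic there with `|T̃(z)| ≤ ‖T‖`. -/
theorem stmt6
    {E : Type*} [NormedAddCommGroup E] [NormedSpace ℂ E] [CompleteSpace E]
    (ι : E →ₗ[ℂ] (ℕ → ℂ)) (hι : Function.Injective ι)
    (e : ℕ → E) (he : ∀ k : ℕ, ι (e k) = Pi.single k 1)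
    (hdense : Dense (Submodule.span ℂ (Set.range e) : Set E))
    (hcoord : ∀ n : ℕ, Continuous fun x : E => ι x n)
    -- (ℋ3), strengthened so that each `γ_z` is an isometry of `𝐄`:
    (Γ : ℂ → E → E)
    (hΓ : ∀ z : ℂ, ‖z‖ = 1 → ∀ x : E, ∀ n : ℕ, ι (Γ z x) n = z ^ n * ι x n)
    (hΓiso : ∀ z : ℂ, ‖z‖ = 1 → ∀ x : E, ‖Γ z x‖ = ‖x‖)
    -- `𝐒` is not bounded:
    (hSnb : ¬ ∀ x : E, ∃ y : E, ι y 0 = 0 ∧ ∀ n : ℕ, ι y (n + 1) = ι x n)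
    -- `𝐒₋₁` is bounded, with restriction `Mop` to `𝐄`:
    (Mop : E →L[ℂ] E)
    (hMop : ∀ x : E, ∀ n : ℕ, ι (Mop x) n = ι x (n + 1))
    -- `T` is a Toeplitz operator on `𝐄`:
    (T : E →L[ℂ] E)
    (hT : ∀ k n : ℕ, ι (T (e (k + 1))) (n + 1) = ι (T (e k)) n)
    -- `Th` is the symbol sequence `T̂`:
    (Th : ℤ → ℂ)
    (hTh₁ : ∀ n : ℕ, Th n = ι (T (e 0)) n)
    (hTh₂ : ∀ n : ℕ, Th (-(n : ℤ)) = ι (T (e n)) 0) :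
    ∃ f : ℂ → ℂ,
      (∀ z ∈ {z : ℂ | (spectralRadius ℂ Mop)⁻¹ < (‖z‖₊ : ℝ≥0∞)},
        HasSum (fun n : ℤ => Th n * z ^ n) (f z)) ∧
      DifferentiableOn ℂ f {z : ℂ | (spectralRadius ℂ Mop)⁻¹ < (‖z‖₊ : ℝ≥0∞)} ∧
      ∀ z ∈ {z : ℂ | (spectralRadius ℂ Mop)⁻¹ < (‖z‖₊ : ℝ≥0∞)}, ‖f z‖ ≤ ‖T‖ := by
  have havg := aux_average ι hι e he hdense hcoord Γ hΓ hΓiso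
  have he' : ∀ k j : ℕ, ι (e k) j = if j = k then 1 else 0 := by
    intro k j; rw [he, Pi.single_apply]
  have hMpow : ∀ (m : ℕ) (x : E) (n : ℕ), ι ((Mop ^ m) x) n = ι x (n + m) := by
    intro m
    induction m with
    | zero => intro x n; simp
    | succ m ih =>
      intro x n
      rw [pow_succ, mul_apply_eq_comp, ih, hMop]; rfl
  have hMe : ∀ m n, (Mop ^ m) (e (n + m)) = e n := by
    intro m n
    apply hι; ext j
    rw [hMpow, he', he']
    simp
  have hMe0 : ∀ m n, n < m → (Mop ^ m) (e n) = 0 := by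
    intro m n h
    apply hι; ext j
    rw [hMpow, he', if_neg (by omega)]; simp
  have hext : ∀ A B : E →L[ℂ] E, (∀ k, A (e k) = B (e k)) → A = B := by
    intro A B h
    apply ContinuousLinearMap.ext_on hdense
    rintro _ ⟨k, rfl⟩
    exact h k
  -- the matrix of `T` is constant on diagonals
  have hdiag : ∀ k n, ι (T (e k)) (n + k) = ι (T (e 0)) n := by
    intro k
    induction k with
    | zero => intro n; rfl
    | succ k ih => intro n; rw [← add_assoc, hT, ih]
  -- positive coefficients vanish
  have hpos : ∀ n : ℕ, ι (T (e 0)) (n + 1) = 0 := by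
    intro n
    by_contra hc
    apply hSnb
    obtain ⟨A, -, hA⟩ := havg T ((n + 1 : ℕ) : ℤ)
    set c := ι (T (e 0)) (n + 1) with hcdef
    let B : E →L[ℂ] E := c⁻¹ • (Mop ^ n * A)
    have hB : ∀ k, B (e k) = e (k + 1) := by
      intro k
      apply hι; ext j
      simp only [B, smul_apply, mul_apply_eq_comp, map_smul,
        Pi.smul_apply, smul_eq_mul]
      rw [hMpow, hA, he']
      by_cases h : j = k + 1
      · subst h
        rw [if_pos (by push_cast; ring), if_pos rfl]
        have := hdiag k (n + 1)
        rw [show k + 1 + n = n + 1 + k by ring, this]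
        exact inv_mul_cancel₀ hc
      · rw [if_neg (by push_cast; omega), if_neg h, mul_zero]
    let φ : ℕ → E →L[ℂ] ℂ := fun j => ⟨(LinearMap.proj j).comp ι, hcoord j⟩
    have hφ : ∀ j x, φ j x = ι x j := fun j x => rfl
    intro x
    refine ⟨B x, ?_, ?_⟩
    · have : (φ 0).comp B = 0 := by
        apply ContinuousLinearMap.ext_on hdense
        rintro _ ⟨k, rfl⟩
        simp [hB, hφ, he']
      rw [← hφ]
      exact congrArg (fun L : E →L[ℂ] ℂ => L x) this
    · intro m
      have : (φ (m + 1)).comp B = φ m := by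
        apply ContinuousLinearMap.ext_on hdense
        rintro _ ⟨k, rfl⟩
        simp [hB, hφ, he']
      rw [← hφ, ← hφ]
      exact congrArg (fun L : E →L[ℂ] ℂ => L x) this
  have hcomm : Commute Mop T := by
    apply hext
    intro k
    apply hι; ext j
    rw [mul_apply_eq_comp, mul_apply_eq_comp, hMop]
    cases k with
    | zero =>
      have := hMe0 1 0 one_pos
      rw [pow_one] at this
      rw [this, hpos]; simp
    | succ k =>
      have := hMe 1 k
      rw [pow_one] at this
      rw [this, hT]
  -- coefficients of operators commuting with `Mop`
  have hcoef : ∀ R : E →L[ℂ] E, Commute Mop R → ∀ k j,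
      ι (R (e (k + j))) j = ι (R (e k)) 0 := by
    intro R hR k j
    have h1 := congrArg (fun L : E →L[ℂ] E => ι (L (e (k + j))) 0) (hR.pow_left j).eq
    simp only [mul_apply_eq_comp] at h1
    rw [hMpow, hMe, zero_add] at h1
    exact h1
  have hcoef0 : ∀ R : E →L[ℂ] E, Commute Mop R → ∀ k j, k < j → ι (R (e k)) j = 0 := by
    intro R hR k j hkj
    have h1 := congrArg (fun L : E →L[ℂ] E => ι (L (e k)) 0) (hR.pow_left j).eq
    simp only [mul_apply_eq_comp] at h1
    rw [hMpow, hMe0 _ _ hkj, zero_add] at h1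
    simpa using h1
  have hbound : ∀ R : E →L[ℂ] E, Commute Mop R → ∀ n,
      ‖ι (R (e n)) 0‖ * ‖Mop ^ n‖ ≤ ‖R‖ := by
    intro R hR n
    obtain ⟨A, hAn, hA⟩ := havg R (-(n : ℤ))
    have : A = ι (R (e n)) 0 • Mop ^ n := by
      apply hext
      intro k
      apply hι; ext j
      simp only [smul_apply, map_smul, Pi.smul_apply, smul_eq_mul]
      rw [hA, hMpow, he']
      by_cases h : j + n = k
      · subst h
        rw [if_pos (by push_cast; ring), if_pos rfl, add_comm j n, hcoef R hR, mul_one]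
      · rw [if_neg (by omega), if_neg h, mul_zero]
    rw [← norm_smul, ← this]
    exact hAn
  have hexp : ∀ R : E →L[ℂ] E, Commute Mop R → ∀ n,
      R (e n) = ∑ p ∈ Finset.HasAntidiagonal.antidiagonal n, ι (R (e p.1)) 0 • e p.2 := by
    intro R hR n
    apply hι; ext j
    rw [map_sum, Finset.sum_apply]
    simp only [map_smul, Pi.smul_apply, smul_eq_mul, he', mul_ite, mul_one, mul_zero]
    by_cases h : j ≤ n
    · obtain ⟨k, rfl⟩ := Nat.exists_eq_add_of_le' h
      rw [hcoef R hR, Finset.sum_eq_single (k, j)]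
      · simp
      · rintro ⟨a, b⟩ hab hne
        rw [Finset.HasAntidiagonal.mem_antidiagonal] at hab
        rw [if_neg]
        rintro rfl
        apply hne
        simp only at hab
        rw [Prod.mk.injEq]
        omega
      · intro h; simp at h
    · rw [hcoef0 R hR _ _ (by omega), Finset.sum_eq_zero]
      rintro ⟨a, b⟩ hab
      rw [Finset.HasAntidiagonal.mem_antidiagonal] at hab
      rw [if_neg]
      simp only at hab ⊢
      omega
  have hmul : ∀ R R' : E →L[ℂ] E, Commute Mop R' → ∀ n,
      ι ((R * R') (e n)) 0 =
        ∑ p ∈ Finset.HasAntidiagonal.antidiagonal n, ι (R' (e p.1)) 0 * ι (R (e p.2)) 0 := by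
    intro R R' hR' n
    rw [mul_apply_eq_comp, hexp R' hR' n]
    simp [map_sum, Finset.sum_apply]
  -- the spectral radius
  have hnt : Nontrivial E := by
    refine ⟨e 0, 0, fun h => ?_⟩
    have := he' 0 0
    rw [h] at this
    simp at this
  obtain ⟨l, hl, hlr⟩ := spectrum.exists_nnnorm_eq_spectralRadius Mop
  have hlpow : ∀ n, ‖l‖ ^ n ≤ ‖Mop ^ n‖ := by
    intro n
    rw [← norm_pow]
    exact spectrum.norm_le_norm_of_mem (spectrum.pow_mem_pow Mop n hl)
  have hregion : {z : ℂ | (spectralRadius ℂ Mop)⁻¹ < (‖z‖₊ : ℝ≥0∞)} =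
      {z : ℂ | 0 < ‖l‖ ∧ ‖l‖⁻¹ < ‖z‖} := by
    ext z
    rw [Set.mem_ofPred_eq, Set.mem_ofPred_eq, ← hlr]
    by_cases h0 : l = 0
    · simp [h0]
    · have : ‖l‖₊ ≠ 0 := by simpa using h0
      rw [← ENNReal.coe_inv this, ENNReal.coe_lt_coe, ← NNReal.coe_lt_coe]
      simp [h0]
  rw [hregion]
  have hterm : ∀ R : E →L[ℂ] E, Commute Mop R → 0 < ‖l‖ → ∀ (w : ℂ) (n : ℕ),
      ‖ι (R (e n)) 0 * w ^ n‖ ≤ ‖R‖ * (‖w‖ / ‖l‖) ^ n := by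
    intro R hR h0 w n
    have h1 : ‖ι (R (e n)) 0‖ * ‖l‖ ^ n ≤ ‖R‖ :=
      (mul_le_mul_of_nonneg_left (hlpow n) (norm_nonneg _)).trans (hbound R hR n)
    rw [norm_mul, norm_pow, div_pow, ← mul_div_assoc, le_div_iff₀ (by positivity)]
    nlinarith [mul_le_mul_of_nonneg_right h1 (by positivity : 0 ≤ ‖w‖ ^ n)]
  have hq : ∀ z : ℂ, 0 < ‖l‖ ∧ ‖l‖⁻¹ < ‖z‖ → ‖z⁻¹‖ / ‖l‖ < 1 := by
    rintro z ⟨h0, hz⟩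
    have hz0 : 0 < ‖z‖ := (inv_pos.2 h0).trans hz
    rw [norm_inv, div_lt_one h0]
    exact inv_lt_of_inv_lt₀ h0 hz
  have hsum : ∀ R : E →L[ℂ] E, Commute Mop R → 0 < ‖l‖ → ∀ w : ℂ, ‖w‖ / ‖l‖ < 1 →
      Summable fun n => ‖ι (R (e n)) 0 * w ^ n‖ := by
    intro R hR h0 w hw
    exact Summable.of_nonneg_of_le (fun _ => norm_nonneg _) (hterm R hR h0 w)
      ((summable_geometric_of_lt_one (by positivity) hw).mul_left _)
  refine ⟨fun z => ∑' n : ℕ, ι (T (e n)) 0 * z⁻¹ ^ n, ?_, ?_, ?_⟩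
  · intro z hz
    have hs := (hsum T hcomm hz.1 _ (hq z hz)).of_norm.hasSum
    have hinj : Function.Injective fun n : ℕ => -(n : ℤ) := by
      intro a b h; simpa using h
    rw [← hinj.hasSum_iff]
    · have hfun : ((fun n : ℤ => Th n * z ^ n) ∘ fun n : ℕ => -(n : ℤ)) =
          fun n : ℕ => ι (T (e n)) 0 * z⁻¹ ^ n := by
        funext n
        simp [hTh₂]
      rw [hfun]
      exact hs
    · intro x hx
      have : 0 < x := by
        by_contra h
        exact hx ⟨x.natAbs, by simp only; omega⟩
      obtain ⟨m, rfl⟩ : ∃ m : ℕ, x = ((m + 1 : ℕ) : ℤ) := ⟨x.natAbs - 1, by omega⟩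
      rw [hTh₁, hpos, zero_mul]
  · intro z hz
    obtain ⟨s, hs1, hs2⟩ := exists_between hz.2
    have hs0 : 0 < s := (inv_pos.2 hz.1).trans hs1
    have hsl : s⁻¹ / ‖l‖ < 1 := by
      rw [div_lt_one hz.1]; exact inv_lt_of_inv_lt₀ hz.1 hs1
    have hU : IsOpen {w : ℂ | s < ‖w‖} := isOpen_lt continuous_const continuous_norm
    have hd := Complex.differentiableOn_tsum_of_summable_norm
      (F := fun (n : ℕ) (w : ℂ) => ι (T (e n)) 0 * w⁻¹ ^ n) (U := {w : ℂ | s < ‖w‖})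
      (u := fun n => ‖T‖ * (s⁻¹ / ‖l‖) ^ n)
      ((summable_geometric_of_lt_one (div_nonneg (by positivity) (norm_nonneg _)) hsl).mul_left _)
      (by
        intro n
        refine DifferentiableOn.const_mul ?_ _
        refine DifferentiableOn.pow ?_ _
        refine differentiableOn_inv.mono ?_
        intro w hw h0
        rw [Set.mem_ofPred_eq] at hw
        rw [h0, norm_zero] at hw
        linarith) hU
      (by
        intro n w hw
        refine (hterm T hcomm hz.1 _ n).trans ?_
        rw [Set.mem_ofPred_eq] at hw
        rw [norm_inv]
        gcongr)
    exact (hd.differentiableAt (hU.mem_nhds hs2)).differentiableWithinAt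
  · intro z hz
    have hw := hq z hz
    set w := z⁻¹
    have hTm : ∀ m : ℕ, Commute Mop (T ^ m) := fun m => hcomm.pow_right m
    have hG : ∀ m : ℕ, ∑' n : ℕ, ι ((T ^ m) (e n)) 0 * w ^ n =
        (∑' n : ℕ, ι (T (e n)) 0 * w ^ n) ^ m := by
      intro m
      induction m with
      | zero =>
        rw [pow_zero, tsum_eq_single 0]
        · simp [he']
        · intro n hn
          simp [he', hn.symm]
      | succ m ih =>
        rw [pow_succ (∑' n : ℕ, ι (T (e n)) 0 * w ^ n), ← ih,
          tsum_mul_tsum_eq_tsum_sum_antidiagonal_of_summable_norm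
            (hsum _ (hTm m) hz.1 w hw) (hsum _ hcomm hz.1 w hw)]
        congr 1; ext n
        rw [pow_succ', hmul T _ (hTm m), Finset.sum_mul]
        refine Finset.sum_congr rfl fun p hp => ?_
        rw [← Finset.HasAntidiagonal.mem_antidiagonal.1 hp, pow_add]
        ring
    refine aux_pow_le (C := (1 - ‖w‖ / ‖l‖)⁻¹) (norm_nonneg _) fun m => ?_
    rw [← norm_pow]
    simp only
    rw [← hG m]
    have hgeo := (hasSum_geometric_of_lt_one (by positivity) hw).mul_left ‖T ^ m‖
    refine (tsum_of_norm_bounded hgeo (hterm _ (hTm m) hz.1 w)).trans ?_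
    rw [mul_comm]
    have : 0 ≤ (1 - ‖w‖ / ‖l‖)⁻¹ := inv_nonneg.2 (by linarith)
    exact mul_le_mul_of_nonneg_left (norm_pow_le T m) this
end

section
/- Let M be a multiplier on E and for k ∈ ℕ set φ_k = Σ_{n=−k}^{k} (1 − |n|/(k+1)) M̂(n) e_n ∈ F(ℤ). Then for every x ∈ E the convolution φ_k ∗ x (defined pointwise by (φ_k ∗ x)(m) = Σ_{n=−k}^{k} (1 − |n|/(k+1)) M̂(n) x(m−n)) belongs to E, satisfies ‖φ_k ∗ x‖ ≤ ‖M‖·‖x‖, and lim_{k→∞} ‖φ_k ∗ x − Mx‖ = 0. -/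
open Filter MeasureTheory AddCircle

noncomputable section FejerAux

lemma int_fourier (n : ℤ) : ∫ t : UnitAddCircle, (fourier n t : ℂ) ∂haarAddCircle = if n = 0 then 1 else 0 := by
  have h := (orthonormal_iff_ite.1 (orthonormal_fourier (T := (1:ℝ)))) 0 n
  rw [ContinuousMap.inner_toLp (haarAddCircle (T := (1:ℝ))) (fourier 0) (fourier n)] at h
  simpa [eq_comm] using h

lemma count (k : ℕ) (n : ℤ) :
    (∑ a ∈ Finset.range (k+1), ∑ b ∈ Finset.range (k+1), if (a:ℤ) - b + n = 0 then (1:ℂ) else 0)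
     = (((k:ℤ)+1-|n|).toNat : ℂ) := by
  have h1 : ∀ a ∈ Finset.range (k+1), (∑ b ∈ Finset.range (k+1), if (a:ℤ) - b + n = 0 then (1:ℂ) else 0) =
      if 0 ≤ (a:ℤ) + n ∧ (a:ℤ) + n ≤ k then 1 else 0 := by
    intro a _
    split_ifs with h
    · rw [Finset.sum_eq_single ((a:ℤ)+n).toNat]
      · rw [if_pos (by omega)]
      · intro b _ hb; rw [if_neg (by omega)]
      · intro hb; simp at hb; omega
    · apply Finset.sum_eq_zero
      intro b hb
      simp at hb
      rw [if_neg (by omega)]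
  rw [Finset.sum_congr rfl h1, Finset.sum_boole]
  congr 1
  have : (Finset.range (k+1)).filter (fun a : ℕ => 0 ≤ (a:ℤ) + n ∧ (a:ℤ) + n ≤ k)
     = Finset.Ico ((-n).toNat) ((k+1 - n.toNat)) := by
    ext a
    simp only [Finset.mem_filter, Finset.mem_range, Finset.mem_Ico]
    omega
  rw [this, Nat.card_Ico]
  rcases abs_cases n with h | h <;> omega

/-- Fejer coefficient -/
def cf (k : ℕ) (n : ℤ) : ℂ := (((k:ℤ)+1-|n|).toNat : ℂ) / (k+1)

/-- Fejer kernel -/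
def fej (k : ℕ) (t : UnitAddCircle) : ℝ := ‖∑ a ∈ Finset.range (k+1), fourier (a:ℤ) t‖^2 / (k+1)

lemma fej_cont (k : ℕ) : Continuous (fej k) := by
  unfold fej; fun_prop

lemma fej_nonneg (k : ℕ) (t) : 0 ≤ fej k t := by unfold fej; positivity

lemma fej_eq (k : ℕ) (t) : (fej k t : ℂ) =
   (∑ a ∈ Finset.range (k+1), ∑ b ∈ Finset.range (k+1), fourier ((a:ℤ)-b) t) / (k+1) := by
  unfold fej
  push_cast
  rw [← Complex.mul_conj', map_sum, Finset.sum_mul_sum]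
  simp only [sub_eq_add_neg, fourier_add, fourier_neg]

lemma fej_coef (k : ℕ) (n : ℤ) : ∫ t, (fej k t : ℂ) * fourier n t ∂haarAddCircle = cf k n := by
  have hi : ∀ n : ℤ, Integrable (fun t : UnitAddCircle => (fourier n t : ℂ)) haarAddCircle := fun n =>
    (by fun_prop : Continuous _).integrable_of_hasCompactSupport (HasCompactSupport.of_compactSpace _)
  have : ∀ t, (fej k t : ℂ) * fourier n t =
     (∑ a ∈ Finset.range (k+1), ∑ b ∈ Finset.range (k+1), fourier ((a:ℤ)-b+n) t) / (k+1) := by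
    intro t
    rw [fej_eq, div_mul_eq_mul_div, Finset.sum_mul]
    simp only [Finset.sum_mul, fourier_add]
  simp only [this]
  rw [integral_div, integral_finsetSum _ (fun a _ => integrable_finsetSum _ (fun b _ => hi _))]
  simp_rw [integral_finsetSum _ (fun b _ => hi _), int_fourier]
  rw [count, cf]

lemma fej_int (k : ℕ) : ∫ t, fej k t ∂haarAddCircle = 1 := by
  have h := fej_coef k 0
  have h2 : cf k 0 = 1 := by
    unfold cf
    have : ((k:ℤ)+1-|0|).toNat = k+1 := by simp
    rw [this]; push_cast; exact div_self (by exact_mod_cast Nat.succ_ne_zero k)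
  rw [h2] at h
  simp only [fourier_zero, mul_one] at h
  rw [integral_complex_ofReal] at h
  exact_mod_cast h

lemma cf_eq (k : ℕ) (n : ℤ) (hn : |n| ≤ k) :
   cf k n = (((1 : ℝ) - ((|n| : ℤ) : ℝ) / ((k : ℝ) + 1) : ℝ) : ℂ) := by
  unfold cf
  generalize |n| = a at hn ⊢
  have h : ((((k:ℤ)+1-a).toNat : ℤ) : ℂ) = (((k:ℤ)+1-a : ℤ) : ℂ) := by
    rw [Int.toNat_of_nonneg (by omega)]
  have h0 : (k:ℂ)+1 ≠ 0 := by exact_mod_cast Nat.succ_ne_zero k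
  rw [Int.cast_natCast] at h
  rw [h]
  push_cast
  field_simp

lemma cf_zero (k : ℕ) (n : ℤ) (hn : ¬ |n| ≤ k) : cf k n = 0 := by
  unfold cf
  rw [Int.toNat_of_nonpos (by omega)]; simp

lemma cf_tendsto (n : ℤ) : Tendsto (fun k => cf k n) atTop (nhds 1) := by
  have h : Tendsto (fun k : ℕ => (1 : ℝ) - ((|n| : ℤ) : ℝ) / ((k : ℝ) + 1)) atTop (nhds (1 - 0)) :=
    tendsto_const_nhds.sub (tendsto_const_nhds.div_atTop
      (tendsto_atTop_add_const_right _ _ tendsto_natCast_atTop_atTop))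
  rw [sub_zero] at h
  have h2 := (Complex.continuous_ofReal.tendsto 1).comp h
  rw [Complex.ofReal_one] at h2
  refine h2.congr' ?_
  filter_upwards [eventually_ge_atTop n.natAbs] with k hk
  rw [cf_eq k n (by rw [Int.abs_eq_natAbs]; exact_mod_cast hk)]; rfl

variable {E : Type*} [NormedAddCommGroup E] [NormedSpace ℂ E]

lemma mk_op (k : ℕ) (G : UnitAddCircle → E →L[ℂ] E) (hG : ∀ x, Continuous fun t => G t x) (C : ℝ)
    (hb : ∀ t x, ‖G t x‖ ≤ C * ‖x‖) :
    ∃ L : E →L[ℂ] E, (∀ x, ‖L x‖ ≤ C * ‖x‖) ∧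
      ∀ x, L x = ∫ t, (fej k t : ℂ) • G t x ∂haarAddCircle := by
  have hc : ∀ x, Continuous fun t => (fej k t : ℂ) • G t x := fun x =>
    (Complex.continuous_ofReal.comp (fej_cont k)).smul (hG x)
  have hi : ∀ x, Integrable (fun t => (fej k t : ℂ) • G t x) haarAddCircle := fun x =>
    (hc x).integrable_of_hasCompactSupport (HasCompactSupport.of_compactSpace _)
  have hi2 : Integrable (fun t => fej k t) haarAddCircle := 
    (fej_cont k).integrable_of_hasCompactSupport (HasCompactSupport.of_compactSpace _)
  have hbd : ∀ x, ‖∫ t, (fej k t : ℂ) • G t x ∂haarAddCircle‖ ≤ C * ‖x‖ := by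
    intro x
    calc _ ≤ ∫ t, fej k t * (C * ‖x‖) ∂haarAddCircle := by
          apply norm_integral_le_of_norm_le (hi2.mul_const _)
          refine Eventually.of_forall fun t => ?_
          rw [norm_smul, Complex.norm_real, Real.norm_of_nonneg (fej_nonneg k t)]
          exact mul_le_mul_of_nonneg_left (hb t x) (fej_nonneg k t)
      _ = C * ‖x‖ := by rw [integral_mul_const, fej_int, one_mul]
  refine ⟨LinearMap.mkContinuous
    { toFun := fun x => ∫ t, (fej k t : ℂ) • G t x ∂haarAddCircle
      map_add' := fun x y => by
        simp only [map_add, smul_add]; exact integral_add (hi x) (hi y)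
      map_smul' := fun c x => by
        simp only [map_smul, RingHom.id_apply]
        rw [← integral_smul]
        simp only [smul_comm c] } C hbd, hbd, fun x => rfl⟩

lemma tendsto_dense (e : ℤ → E)
    (hdense : Dense (Submodule.span ℂ (Set.range e) : Set E))
    (L : ℕ → E →L[ℂ] E) (C : ℝ) (hC : 0 ≤ C) (hL : ∀ k x, ‖L k x‖ ≤ C * ‖x‖) (A : E →L[ℂ] E)
    (h : ∀ j, Tendsto (fun k => L k (e j)) atTop (nhds (A (e j)))) (x : E) :
    Tendsto (fun k => L k x) atTop (nhds (A x)) := by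
  have hs : ∀ x ∈ Submodule.span ℂ (Set.range e), Tendsto (fun k => L k x) atTop (nhds (A x)) := by
    intro x hx
    induction hx using Submodule.span_induction with
    | mem x hx => obtain ⟨j, rfl⟩ := hx; exact h j
    | zero => simp
    | add x y _ _ hx hy => simpa using hx.add hy
    | smul c x _ hx => simpa using hx.const_smul c
  rw [Metric.tendsto_atTop]
  intro ε hε
  set D := C + ‖A‖ + 1 with hD
  have hDpos : 0 < D := by positivity
  obtain ⟨u, hu, hxu⟩ := Metric.dense_iff.1 hdense x (ε / (2 * D)) (by positivity)
  obtain ⟨N, hN⟩ := Metric.tendsto_atTop.1 (hs u hxu) (ε/2) (by positivity)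
  refine ⟨N, fun k hk => ?_⟩
  have h1 := hN k hk
  rw [dist_eq_norm] at h1 ⊢
  have h2 : ‖x - u‖ < ε / (2*D) := by rw [← dist_eq_norm, dist_comm]; exact hu
  have h3 : L k x - A x = L k (x-u) + (L k u - A u) - A (x - u) := by simp
  have h4 := hL k (x-u)
  have h5 := A.le_opNorm (x-u)
  have h6 : D * ‖x-u‖ < ε/2 := by
    calc _ < D * (ε/(2*D)) := by gcongr
      _ = ε/2 := by field_simp
  calc _ ≤ ‖L k (x-u)‖ + ‖L k u - A u‖ + ‖A (x-u)‖ := by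
        rw [h3]; exact (norm_sub_le _ _).trans (by gcongr; exact norm_add_le _ _)
    _ < ε := by rw [hD] at h6; nlinarith [norm_nonneg (x-u)]

end FejerAux

/-- For a multiplier `M` on `E` and `φ_k = Σ_{n=−k}^{k} (1 − |n|/(k+1)) M̂(n) e_n`,
the convolution `φ_k ∗ x` belongs to `E` (here `y k` is the element of `E` whose
coordinate sequence is `φ_k ∗ x`), satisfies `‖φ_k ∗ x‖ ≤ ‖M‖·‖x‖`, and
`φ_k ∗ x → Mx` in `E`. -/
theorem stmt10
    {E : Type*} [NormedAddCommGroup E] [NormedSpace ℂ E] [CompleteSpace E]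
    (ι : E →ₗ[ℂ] (ℤ → ℂ)) (hι : Function.Injective ι)
    (e : ℤ → E) (he : ∀ k : ℤ, ι (e k) = Pi.single k 1)
    (hdense : Dense (Submodule.span ℂ (Set.range e) : Set E))
    (hcoord : ∀ n : ℤ, Continuous fun x : E => ι x n)
    -- (H3), strengthened so that each `ψ_z` is an isometry of `E`:
    (Ψ : ℂ → E → E)
    (hΨ : ∀ z : ℂ, ‖z‖ = 1 → ∀ x : E, ∀ n : ℤ, ι (Ψ z x) n = ι x n * z ^ n)
    (hΨiso : ∀ z : ℂ, ‖z‖ = 1 → ∀ x : E, ‖Ψ z x‖ = ‖x‖)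
    -- `M` is a multiplier on `E`:
    (M : E →L[ℂ] E)
    (hM : ∀ k n : ℤ, ι (M (e (k + 1))) n = ι (M (e k)) (n - 1)) :
    ∀ x : E, ∃ y : ℕ → E,
      (∀ k : ℕ, ∀ m : ℤ, ι (y k) m =
        ∑ n ∈ Finset.Icc (-(k : ℤ)) (k : ℤ),
          (((((1 : ℝ) - ((|n| : ℤ) : ℝ) / ((k : ℝ) + 1)) : ℝ) : ℂ) * ι (M (e 0)) n)
            * ι x (m - n)) ∧
      (∀ k : ℕ, ‖y k‖ ≤ ‖M‖ * ‖x‖) ∧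
      Tendsto (fun k : ℕ => ‖y k - M x‖) atTop (nhds 0) := by
  -- coordinate functionals
  let cm : ℤ → E →L[ℂ] ℂ := fun m =>
    { toLinearMap := (LinearMap.proj m).comp ι, cont := hcoord m }
  have hcm : ∀ m x, cm m x = ι x m := fun m x => rfl
  -- the operators V t
  have hz : ∀ t : UnitAddCircle, ‖(toCircle t : ℂ)‖ = 1 := fun t => Circle.norm_coe _
  have hzf : ∀ (t : UnitAddCircle) (n : ℤ), (toCircle t : ℂ) ^ n = fourier n t := by
    intro t n
    rw [fourier_apply, toCircle_zsmul, Circle.coe_zpow]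
  have hV : ∃ V : UnitAddCircle → E →L[ℂ] E, (∀ t x n, ι (V t x) n = ι x n * fourier n t) ∧
      ∀ t x, ‖V t x‖ = ‖x‖ := by
    refine ⟨fun t => LinearMap.mkContinuous
      { toFun := fun x => Ψ (toCircle t) x
        map_add' := fun x y => hι (by
          ext n
          simp only [map_add, Pi.add_apply, hΨ _ (hz t), add_mul])
        map_smul' := fun c x => hι (by
          ext n
          simp only [map_smul, Pi.smul_apply, hΨ _ (hz t), smul_eq_mul, RingHom.id_apply,
            mul_assoc]) } 1 (fun x => ?_), ?_, ?_⟩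
    · rw [one_mul]; exact (hΨiso _ (hz t) x).le
    · intro t x n
      rw [← hzf]; exact hΨ _ (hz t) x n
    · intro t x
      exact hΨiso _ (hz t) x
  obtain ⟨V, hVc, hVn⟩ := hV
  have hVe : ∀ t j, V t (e j) = (fourier j t : ℂ) • e j := by
    intro t j
    apply hι
    ext n
    rw [hVc, map_smul, he, Pi.smul_apply, smul_eq_mul]
    by_cases h : n = j
    · subst h; simp
    · simp [Pi.single_eq_of_ne h]
  have hVs : ∀ x, Continuous fun t => V t x := by
    have hs : ∀ x ∈ Submodule.span ℂ (Set.range e), Continuous fun t => V t x := by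
      intro x hx
      induction hx using Submodule.span_induction with
      | mem x hx =>
        obtain ⟨j, rfl⟩ := hx
        simp only [hVe]
        fun_prop
      | zero => simpa using continuous_const
      | add x y _ _ hx hy => simp only [map_add]; exact hx.add hy
      | smul c x _ hx => simp only [map_smul]; exact hx.const_smul c
    intro x
    refine continuous_of_uniform_approx_of_continuous fun u hu => ?_
    obtain ⟨ε, hε, hεu⟩ := Metric.mem_uniformity_dist.1 hu
    obtain ⟨w, hw, hxw⟩ := Metric.dense_iff.1 hdense x ε hε
    refine ⟨fun t => V t w, hs w hxw, fun t => hεu ?_⟩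
    rw [dist_eq_norm, ← map_sub, hVn, ← dist_eq_norm, dist_comm]
    exact hw
  have hVj : ∀ w : UnitAddCircle → E, Continuous w → Continuous fun t => V t (w t) := by
    intro w hw
    rw [continuous_iff_continuousAt]
    intro s
    have h1 : Tendsto (fun t => V t (w t - w s)) (nhds s) (nhds 0) := by
      rw [tendsto_zero_iff_norm_tendsto_zero]
      simp only [hVn]
      have : Continuous fun t => ‖w t - w s‖ := by fun_prop
      simpa using this.tendsto s
    have h2 : Tendsto (fun t => V t (w s)) (nhds s) (nhds (V s (w s))) := (hVs (w s)).tendsto s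
    have h3 := h1.add h2
    simpa [ContinuousAt] using h3
  -- the averaged multipliers
  have hL : ∀ k : ℕ, ∃ L : E →L[ℂ] E, (∀ x, ‖L x‖ ≤ ‖M‖ * ‖x‖) ∧
      ∀ x, L x = ∫ t, (fej k t : ℂ) • ((V t).comp (M.comp (V (-t)))) x ∂haarAddCircle := by
    intro k
    apply mk_op
    · intro x
      apply hVj (fun t => M (V (-t) x))
      exact M.continuous.comp ((hVs x).comp continuous_neg)
    · intro t x
      simp only [ContinuousLinearMap.comp_apply, hVn]
      exact (M.le_opNorm _).trans (by rw [hVn])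
  choose L hLb hLe using hL
  have hP : ∀ (j : ℤ) (k : ℕ), ∃ P : E →L[ℂ] E, (∀ x, ‖P x‖ ≤ 1 * ‖x‖) ∧
      ∀ x, P x = ∫ t, (fej k t : ℂ) • ((fourier (-j) t : ℂ) • V t) x ∂haarAddCircle := by
    intro j k
    apply mk_op
    · intro x
      simp only [ContinuousLinearMap.smul_apply]
      exact (fourier (-j)).continuous.smul (hVs x)
    · intro t x
      simp only [ContinuousLinearMap.smul_apply, norm_smul, hVn]
      rw [← hzf, norm_zpow, hz, one_zpow]
  choose P hPb hPe using hP
  have hneg : ∀ (j : ℤ) (t : UnitAddCircle), (fourier j (-t) : ℂ) = fourier (-j) t := by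
    intro j t
    simp [fourier_apply]
  have hLP : ∀ k j, L k (e j) = P j k (M (e j)) := by
    intro k j
    rw [hLe, hPe]
    simp only [ContinuousLinearMap.comp_apply, ContinuousLinearMap.smul_apply, hVe, hneg, map_smul]
  have hPm : ∀ j k m, P j k (e m) = cf k (m - j) • e m := by
    intro j k m
    rw [hPe, ← fej_coef, ← integral_smul_const]
    congr 1
    ext t
    simp only [ContinuousLinearMap.smul_apply, hVe, smul_smul]
    rw [sub_eq_add_neg, fourier_add]
    congr 1
    ring
  have hPc : ∀ j k m u, ι (P j k u) m = cf k (m - j) * ι u m := by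
    intro j k m u
    have : (cm m).comp (P j k) = cf k (m - j) • cm m := by
      apply ContinuousLinearMap.ext_on hdense
      rintro _ ⟨i, rfl⟩
      simp only [ContinuousLinearMap.comp_apply, ContinuousLinearMap.smul_apply, hPm, map_smul,
        hcm, he, smul_eq_mul]
      by_cases h : m = i
      · subst h; rfl
      · simp [Pi.single_eq_of_ne h]
    exact congrArg (fun f : E →L[ℂ] ℂ => f u) this
  have hPt : ∀ j u, Tendsto (fun k => P j k u) atTop (nhds u) := by
    intro j u
    refine tendsto_dense e hdense (P j) 1 zero_le_one (hPb j) (ContinuousLinearMap.id ℂ E) ?_ u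
    intro m
    simp only [hPm, ContinuousLinearMap.id_apply]
    simpa using (cf_tendsto (m - j)).smul_const (e m)
  have hLt : ∀ x, Tendsto (fun k => L k x) atTop (nhds (M x)) := by
    refine tendsto_dense e hdense L ‖M‖ (norm_nonneg _) hLb M ?_
    intro j
    simp only [hLP]
    exact hPt j _
  have hMj : ∀ j n : ℤ, ι (M (e j)) n = ι (M (e 0)) (n - j) := by
    intro j
    induction j using Int.induction_on with
    | zero => simp
    | succ i ih => intro n; rw [hM, ih]; congr 1; ring_nf
    | pred i ih =>
      intro n
      have h := hM (-(i:ℤ) - 1) (n + 1)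
      rw [sub_add_cancel, add_sub_cancel_right, ih] at h
      rw [← h]; congr 1; ring_nf
  intro x
  refine ⟨fun k => L k x, ?_, fun k => hLb k x, ?_⟩
  · intro k m
    have : (cm m).comp (L k) = ∑ n ∈ Finset.Icc (-(k : ℤ)) (k : ℤ),
          (((((1 : ℝ) - ((|n| : ℤ) : ℝ) / ((k : ℝ) + 1)) : ℝ) : ℂ) * ι (M (e 0)) n)
            • cm (m - n) := by
      apply ContinuousLinearMap.ext_on hdense
      rintro _ ⟨j, rfl⟩
      rw [ContinuousLinearMap.comp_apply, hcm, hLP, hPc, hMj, ContinuousLinearMap.sum_apply]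
      simp only [ContinuousLinearMap.smul_apply, hcm, he, smul_eq_mul]
      by_cases h : |m - j| ≤ k
      · rw [Finset.sum_eq_single (m - j)]
        · rw [sub_sub_cancel, Pi.single_eq_same, mul_one, cf_eq k _ h]
        · intro n _ hn
          rw [Pi.single_eq_of_ne (by omega), mul_zero]
        · intro hn
          exact absurd (Finset.mem_Icc.2 (abs_le.1 h)) hn
      · rw [cf_zero k _ h, zero_mul]
        symm
        apply Finset.sum_eq_zero
        intro n hn
        have hne : m - n ≠ j := by
          rintro rfl
          apply h
          rw [sub_sub_cancel]
          exact abs_le.2 (Finset.mem_Icc.1 hn)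
        rw [Pi.single_eq_of_ne hne, mul_zero]
    have h2 := congrArg (fun f : E →L[ℂ] ℂ => f x) this
    simpa only [ContinuousLinearMap.comp_apply, ContinuousLinearMap.sum_apply,
      ContinuousLinearMap.smul_apply, hcm, smul_eq_mul] using h2
  · exact tendsto_iff_norm_sub_tendsto_zero.1 (hLt x)
end

section
/- Assume 𝐒 is bounded but 𝐒₋₁ is not bounded on 𝐄. Let φ ∈ ℂ^ℤ be finitely supported with φ(n) = 0 for all n < 0. Then the operator T_φ : x ↦ P⁺(φ∗x) maps 𝐄 boundedly into 𝐄, and |φ̃(z)| ≤ ‖T_φ‖ for every z ∈ ℂ with |z| ≤ ρ(𝐒), where φ̃(z) = Σ_n φ(n) zⁿ (a finite sum, i.e. a polynomial in z) and ‖T_φ‖ is the operator norm of T_φ. -/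
open scoped ENNReal

lemma aux_pow {E : Type*} [NormedAddCommGroup E] [NormedSpace ℂ E]
    (ι : E →ₗ[ℂ] (ℕ → ℂ)) (Sop : E →L[ℂ] E)
    (hSop : ∀ x : E, ι (Sop x) 0 = 0 ∧ ∀ n : ℕ, ι (Sop x) (n + 1) = ι x n) (k : ℕ) :
    ∀ (x : E) (m : ℕ), ι ((Sop ^ k) x) m = if k ≤ m then ι x (m - k) else 0 := by
  induction k with
  | zero => intro x m; simp
  | succ k ih =>
    intro x m
    rw [pow_succ', ContinuousLinearMap.mul_apply]
    cases m with
    | zero => simp [(hSop _).1]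
    | succ m => rw [(hSop _).2, ih]; simp

open scoped Pointwise in
lemma aux_rot {E : Type*} [NormedAddCommGroup E] [NormedSpace ℂ E]
    (ι : E →ₗ[ℂ] (ℕ → ℂ)) (hι : Function.Injective ι)
    (Γ : ℂ → E → E)
    (hΓ : ∀ z : ℂ, ‖z‖ = 1 → ∀ x : E, ∀ n : ℕ, ι (Γ z x) n = z ^ n * ι x n)
    (C : ℝ) (hC : ∀ z : ℂ, ‖z‖ = 1 → ∀ x : E, ‖Γ z x‖ ≤ C * ‖x‖)
    (Sop : E →L[ℂ] E)
    (hSop : ∀ x : E, ι (Sop x) 0 = 0 ∧ ∀ n : ℕ, ι (Sop x) (n + 1) = ι x n)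
    (z w : ℂ) (hz : ‖z‖ = 1) (hw : w ∈ spectrum ℂ Sop) : z * w ∈ spectrum ℂ Sop := by
  have hz0 : z ≠ 0 := by rintro rfl; simp at hz
  have hzi : ‖z⁻¹‖ = 1 := by simp [hz]
  have key : ∀ u : ℂ, ‖u‖ = 1 → ∃ G : E →L[ℂ] E, ∀ x, G x = Γ u x := by
    intro u hu
    refine ⟨LinearMap.mkContinuous
      { toFun := Γ u
        map_add' := fun x y => hι ?_
        map_smul' := fun c x => hι ?_ } C (hC u hu), fun x => rfl⟩
    · funext n; simp [hΓ u hu, mul_add]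
    · funext n; simp [hΓ u hu]; ring
  obtain ⟨G, hG⟩ := key z hz
  obtain ⟨H, hH⟩ := key z⁻¹ hzi
  have h1 : G * H = 1 := by
    ext x; apply hι; funext n
    simp [hG, hH, hΓ z hz, hΓ _ hzi, hz0]
  have h2 : H * G = 1 := by
    ext x; apply hι; funext n
    simp [hG, hH, hΓ z hz, hΓ _ hzi, hz0]
  let U : (E →L[ℂ] E)ˣ := ⟨G, H, h1, h2⟩
  have h3 : (U : E →L[ℂ] E) * Sop * (U⁻¹ : (E →L[ℂ] E)ˣ) = z • Sop := by
    change G * Sop * H = z • Sop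
    ext x; apply hι; funext n
    cases n with
    | zero => simp [hG, hΓ z hz, (hSop _).1]
    | succ n =>
      simp [hG, hH, hΓ z hz, (hSop _).2, hΓ _ hzi]
      field_simp
      ring
  have h4 : spectrum ℂ (z • Sop) = spectrum ℂ Sop := by
    rw [← h3, spectrum.units_conjugate]
  rw [← h4]
  have := spectrum.unit_smul_eq_smul (R := ℂ) Sop (Units.mk0 z hz0)
  change spectrum ℂ (z • Sop) = z • spectrum ℂ Sop at this
  rw [this]
  exact Set.smul_mem_smul_set hw

/-- If `𝐒` is bounded but `𝐒₋₁` is not bounded on `𝐄`, then for every finitely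
supported `φ : ℤ → ℂ` with `φ(n) = 0` for `n < 0`, the operator `T_φ : x ↦ P⁺(φ∗x)`
maps `𝐄` boundedly into `𝐄`, and `|φ̃(z)| ≤ ‖T_φ‖` for every `z` with `|z| ≤ ρ(𝐒)`. -/
theorem stmt19
    {E : Type*} [NormedAddCommGroup E] [NormedSpace ℂ E] [CompleteSpace E]
    (ι : E →ₗ[ℂ] (ℕ → ℂ)) (hι : Function.Injective ι)
    (e : ℕ → E) (he : ∀ k : ℕ, ι (e k) = Pi.single k 1)
    (hdense : Dense (Submodule.span ℂ (Set.range e) : Set E))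
    (hcoord : ∀ n : ℕ, Continuous fun x : E => ι x n)
    (Γ : ℂ → E → E)
    (hΓ : ∀ z : ℂ, ‖z‖ = 1 → ∀ x : E, ∀ n : ℕ, ι (Γ z x) n = z ^ n * ι x n)
    (hΓbdd : ∃ C : ℝ, ∀ z : ℂ, ‖z‖ = 1 → ∀ x : E, ‖Γ z x‖ ≤ C * ‖x‖)
    -- `𝐒` is bounded, with restriction `Sop` to `𝐄`:
    (Sop : E →L[ℂ] E)
    (hSop : ∀ x : E, ι (Sop x) 0 = 0 ∧ ∀ n : ℕ, ι (Sop x) (n + 1) = ι x n)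
    -- `𝐒₋₁` is not bounded:
    (hMnb : ¬ ∀ x : E, ∃ y : E, ∀ n : ℕ, ι y n = ι x (n + 1))
    (φ : ℤ →₀ ℂ) (hφ : ∀ n : ℤ, n < 0 → φ n = 0) :
    ∃ Tφ : E →L[ℂ] E,
      (∀ x : E, ∀ m : ℕ, ι (Tφ x) m =
        ∑ j ∈ φ.support, φ j * (if 0 ≤ (m : ℤ) - j then ι x ((m : ℤ) - j).toNat else 0)) ∧
      ∀ z : ℂ, (‖z‖₊ : ℝ≥0∞) ≤ spectralRadius ℂ Sop →
        ‖∑ j ∈ φ.support, φ j * z ^ j‖ ≤ ‖Tφ‖ := by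
  obtain ⟨C, hC⟩ := hΓbdd
  have he0 : e 0 ≠ 0 := by
    intro h
    have := congrFun (he 0) 0
    simp [h] at this
  haveI : Nontrivial E := ⟨⟨e 0, 0, he0⟩⟩
  have hnn : ∀ j ∈ φ.support, 0 ≤ j := by
    intro j hj
    by_contra h
    exact (Finsupp.mem_support_iff.1 hj) (hφ j (not_le.1 h))
  let p : Polynomial ℂ := ∑ j ∈ φ.support, Polynomial.C (φ j) * Polynomial.X ^ j.toNat
  have hp : ∀ z : ℂ, ∑ j ∈ φ.support, φ j * z ^ j = p.eval z := by
    intro z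
    simp only [p, Polynomial.eval_finset_sum, Polynomial.eval_mul, Polynomial.eval_C,
      Polynomial.eval_pow, Polynomial.eval_X]
    refine Finset.sum_congr rfl fun j hj => ?_
    obtain ⟨k, rfl⟩ := Int.eq_ofNat_of_zero_le (hnn j hj)
    simp
  refine ⟨Polynomial.aeval Sop p, ?_, ?_⟩
  · intro x m
    have h : (Polynomial.aeval Sop p) x = ∑ j ∈ φ.support, φ j • (Sop ^ j.toNat) x := by
      simp [p, map_sum, ← Algebra.smul_def]
    rw [h, map_sum, Finset.sum_apply]
    refine Finset.sum_congr rfl fun j hj => ?_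
    obtain ⟨k, rfl⟩ := Int.eq_ofNat_of_zero_le (hnn j hj)
    rw [map_smul, Pi.smul_apply, smul_eq_mul, aux_pow ι Sop hSop]
    by_cases hk : k ≤ m
    · have : ((m : ℤ) - k).toNat = m - k := by omega
      simp [hk, this]
    · simp [hk]
  · obtain ⟨w, hw, hwr⟩ := spectrum.exists_nnnorm_eq_spectralRadius (A := E →L[ℂ] E) Sop
    have hcirc : ∀ z : ℂ, ‖z‖ = ‖w‖ → ‖p.eval z‖ ≤ ‖Polynomial.aeval Sop p‖ := by
      intro z hz
      have hzs : z ∈ spectrum ℂ Sop := by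
        by_cases hw0 : w = 0
        · have : z = w := by subst hw0; simpa using hz
          rwa [this]
        · have := aux_rot ι hι Γ hΓ C hC Sop hSop (z / w) w
            (by rw [norm_div, hz, div_self (norm_ne_zero_iff.2 hw0)]) hw
          rwa [div_mul_cancel₀ _ hw0] at this
      exact spectrum.norm_le_norm_of_mem
        (spectrum.subset_polynomial_aeval Sop p ⟨z, hzs, rfl⟩)
    intro z hz
    rw [hp]
    rw [← hwr] at hz
    have hz' : ‖z‖ ≤ ‖w‖ := by exact_mod_cast hz
    rcases hz'.eq_or_lt with h | h
    · exact hcirc z h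
    · refine Complex.norm_le_of_forall_mem_frontier_norm_le (U := Metric.ball (0 : ℂ) ‖w‖)
        Metric.isBounded_ball (f := fun z => p.eval z) p.differentiable.diffContOnCl
        (fun y hy => ?_) (subset_closure (by simpa using h))
      have := Metric.frontier_ball_subset_sphere hy
      exact hcirc y (by simpa using this)
end
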